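/- Let F be a pliable family of subsets of a finite ground set V that satisfies symmetry and structural submodularity, let Ê be a set of edges on V, let Ĵ be an inclusion-minimal set of links covering C_Ê, and let {S_ℓ : ℓ∈Ĵ} be a laminar family of witness sets for Ĵ. Let L* be the subfamily of witness sets that cross at least one member of C_Ê. Then for every S∈L* there exists C∈C_Ê such that ψ(C)=S, or ψ(C)=S' where S'∈L* is a child of S (i.e., S'⊊S and no T∈L* satisfies S'⊊T⊊S); here ψ(C) denotes the smallest member of L*∪{V} containing C. -/

import Mathlib

/-- Two subsets `A, B` of the ground set `V` cross if all four sets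
`A ∩ B`, `A \ B`, `B \ A`, `V \ (A ∪ B)` are nonempty. -/
def Crosses {V : Type*} (A B : Set V) : Prop :=
  (A ∩ B).Nonempty ∧ (A \ B).Nonempty ∧ (B \ A).Nonempty ∧
    (Set.univ \ (A ∪ B)).Nonempty

/-- At least two of the four propositions hold. -/
def AtLeastTwo (p q r s : Prop) : Prop :=
  (p ∧ q) ∨ (p ∧ r) ∨ (p ∧ s) ∨ (q ∧ r) ∨ (q ∧ s) ∨ (r ∧ s)

/-- A family `F` of subsets of `V` (with `∅ ∉ F` and `V ∉ F`) is pliable if for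
every pair `A, B ∈ F`, at least two of `A ∩ B`, `A ∪ B`, `A \ B`, `B \ A` are in `F`. -/
def Pliable {V : Type*} (F : Set (Set V)) : Prop :=
  ∅ ∉ F ∧ Set.univ ∉ F ∧
    ∀ A ∈ F, ∀ B ∈ F, AtLeastTwo (A ∩ B ∈ F) (A ∪ B ∈ F) (A \ B ∈ F) (B \ A ∈ F)

/-- `F` satisfies symmetry: `S ∈ F` iff `V \ S ∈ F`. -/
def SymmFamily {V : Type*} (F : Set (Set V)) : Prop :=
  ∀ S : Set V, S ∈ F ↔ (Set.univ \ S) ∈ F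

/-- `F` satisfies structural submodularity: for every crossing pair `A, B ∈ F`,
at least one of `A ∩ B`, `A ∪ B` is in `F` and at least one of `A \ B`, `B \ A` is in `F`. -/
def StructSubmodular {V : Type*} (F : Set (Set V)) : Prop :=
  ∀ A ∈ F, ∀ B ∈ F, Crosses A B →
    ((A ∩ B ∈ F ∨ A ∪ B ∈ F) ∧ (A \ B ∈ F ∨ B \ A ∈ F))

/-- `δ_J(S)`: the edges (unordered pairs) of `J` with exactly one endpoint in `S`. -/
def cutLinks {V : Type*} (J : Set (Sym2 V)) (S : Set V) : Set (Sym2 V) :=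
  {e ∈ J | ∃ x y, e = s(x, y) ∧ x ∈ S ∧ y ∉ S}

/-- `F_Ê`: the members of `F` not covered by the edge set `Ê`. -/
def uncovered {V : Type*} (F : Set (Set V)) (E : Set (Sym2 V)) : Set (Set V) :=
  {S ∈ F | cutLinks E S = ∅}

/-- `C` is an inclusion-minimal member of `F`: `C ∈ F` and no proper subset of `C` is in `F`. -/
def MinimalIn {V : Type*} (F : Set (Set V)) (C : Set V) : Prop :=
  C ∈ F ∧ ∀ S : Set V, S ⊂ C → S ∉ F

/-- `C_Ê`: the family of inclusion-minimal members of `F_Ê`. -/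
def cores {V : Type*} (F : Set (Set V)) (E : Set (Sym2 V)) : Set (Set V) :=
  {C | MinimalIn (uncovered F E) C}


/-- `L*`: witness sets (for the link set `J` with witness assignment `w`) that
cross at least one member of `C_Ê`. -/
def witnessCross {V : Type*} (F : Set (Set V)) (E J : Set (Sym2 V))
    (w : Sym2 V → Set V) : Set (Set V) :=
  {S | (∃ ℓ ∈ J, S = w ℓ) ∧ ∃ C ∈ cores F E, Crosses S C}

/-- `S` is the smallest member of `Lst ∪ {V}` containing `C`. -/
def SmallestContaining {V : Type*} (Lst : Set (Set V)) (C S : Set V) : Prop :=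
  C ⊆ S ∧ ∀ T ∈ insert Set.univ Lst, C ⊆ T → S ⊆ T

/-- `S'` is a child of `S₀` in the family `L`. -/
def IsChild {V : Type*} (L : Set (Set V)) (S₀ S' : Set V) : Prop :=
  S' ∈ L ∧ S' ⊂ S₀ ∧ ¬ ∃ T ∈ L, S' ⊂ T ∧ T ⊂ S₀

theorem mem_cutLinks_mk {V : Type*} {J : Set (Sym2 V)} {S : Set V} {x y : V}
    (h : s(x, y) ∈ J) (hx : x ∈ S) (hy : y ∉ S) : s(x, y) ∈ cutLinks J S :=
  ⟨h, x, y, rfl, hx, hy⟩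

theorem cutLinks_eq_empty_iff {V : Type*} {E : Set (Sym2 V)} {S : Set V} :
    cutLinks E S = ∅ ↔ ∀ x y, s(x, y) ∈ E → x ∈ S → y ∈ S := by
  constructor
  · intro h x y he hx
    by_contra hy
    exact (Set.eq_empty_iff_forall_notMem.1 h) _ (mem_cutLinks_mk he hx hy)
  · intro h
    refine Set.eq_empty_iff_forall_notMem.2 ?_
    rintro _ ⟨he, x, y, rfl, hx, hy⟩
    exact hy (h x y he hx)

theorem cutLinks_inter_eq_empty {V : Type*} {E : Set (Sym2 V)} {A B : Set V}
    (hA : cutLinks E A = ∅) (hB : cutLinks E B = ∅) : cutLinks E (A ∩ B) = ∅ := by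
  rw [cutLinks_eq_empty_iff] at *
  exact fun x y he hx => ⟨hA x y he hx.1, hB x y he hx.2⟩

theorem cutLinks_union_eq_empty {V : Type*} {E : Set (Sym2 V)} {A B : Set V}
    (hA : cutLinks E A = ∅) (hB : cutLinks E B = ∅) : cutLinks E (A ∪ B) = ∅ := by
  rw [cutLinks_eq_empty_iff] at *
  exact fun x y he hx => hx.imp (hA x y he) (hB x y he)

theorem cutLinks_diff_eq_empty {V : Type*} {E : Set (Sym2 V)} {A B : Set V}
    (hA : cutLinks E A = ∅) (hB : cutLinks E B = ∅) : cutLinks E (A \ B) = ∅ := by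
  rw [cutLinks_eq_empty_iff] at *
  exact fun x y he hx => ⟨hA x y he hx.1, fun hy => hx.2 (hB y x (Sym2.eq_swap ▸ he) hy)⟩

theorem Pliable.uncovered {V : Type*} {F : Set (Set V)} (h : Pliable F) (E : Set (Sym2 V)) :
    Pliable (uncovered F E) := by
  refine ⟨fun h0 => h.1 h0.1, fun h0 => h.2.1 h0.1, fun A hA B hB => ?_⟩
  have h1 := cutLinks_inter_eq_empty hA.2 hB.2
  have h2 := cutLinks_union_eq_empty hA.2 hB.2
  have h3 := cutLinks_diff_eq_empty hA.2 hB.2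
  have h4 := cutLinks_diff_eq_empty hB.2 hA.2
  have := h.2.2 A hA.1 B hB.1
  simp only [AtLeastTwo, _root_.uncovered, Set.mem_ofPred_eq, h1, h2, h3, h4, and_true] at this ⊢
  exact this

theorem StructSubmodular.uncovered {V : Type*} {F : Set (Set V)} (h : StructSubmodular F)
    (E : Set (Sym2 V)) : StructSubmodular (uncovered F E) := by
  intro A hA B hB hAB
  have h1 := cutLinks_inter_eq_empty hA.2 hB.2
  have h2 := cutLinks_union_eq_empty hA.2 hB.2
  have h3 := cutLinks_diff_eq_empty hA.2 hB.2
  have h4 := cutLinks_diff_eq_empty hB.2 hA.2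
  have := h A hA.1 B hB.1 hAB
  simp only [_root_.uncovered, Set.mem_ofPred_eq, h1, h2, h3, h4, and_true] at this ⊢
  exact this

theorem MinimalIn.inter_notMem {V : Type*} {U : Set (Set V)} {A K : Set V}
    (hK : MinimalIn U K) (hKA : ¬ K ⊆ A) : A ∩ K ∉ U :=
  hK.2 _ ⟨Set.inter_subset_right, fun h => hKA fun _ hx => (h hx).1⟩

theorem MinimalIn.diff_notMem {V : Type*} {U : Set (Set V)} {A K : Set V}
    (hK : MinimalIn U K) (hAK : (K ∩ A).Nonempty) : K \ A ∉ U :=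
  hK.2 _ ⟨Set.sdiff_subset, fun h => by
    obtain ⟨x, hx, hx'⟩ := hAK
    exact (h hx).2 hx'⟩

theorem MinimalIn.nonempty {V : Type*} {U : Set (Set V)} {K : Set V}
    (hU : Pliable U) (hK : MinimalIn U K) : K.Nonempty :=
  Set.nonempty_iff_ne_empty.2 fun h => hU.1 (h ▸ hK.1)

/-- A member of a pliable family stays in the family when a minimal member that overlaps it
without being contained in it is removed. -/
theorem Pliable.diff_minimal_mem {V : Type*} {U : Set (Set V)} {A K : Set V}
    (hU : Pliable U) (hA : A ∈ U) (hK : MinimalIn U K)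
    (hAK : (K ∩ A).Nonempty) (hKA : ¬ K ⊆ A) : A \ K ∈ U := by
  have h1 := hK.inter_notMem hKA
  have h2 := hK.diff_notMem hAK
  have := hU.2.2 A hA K hK.1
  unfold AtLeastTwo at this
  tauto

theorem MinimalIn.eq_of_inter_nonempty {V : Type*} {U : Set (Set V)} {K L : Set V}
    (hU : Pliable U) (hK : MinimalIn U K) (hL : MinimalIn U L)
    (h : (K ∩ L).Nonempty) : K = L := by
  by_contra hne
  have hKL : ¬ K ⊆ L := fun hs => hL.2 K (hs.ssubset_of_ne hne) hK.1
  exact hL.diff_notMem (Set.inter_comm K L ▸ h) (hU.diff_minimal_mem hL.1 hK h hKL)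

theorem exists_minimalIn_subset {V : Type*} [Finite V] {U : Set (Set V)} {A : Set V}
    (hA : A ∈ U) : ∃ K, MinimalIn U K ∧ K ⊆ A := by
  obtain ⟨K, hKA, hK⟩ := (Set.toFinite U).exists_le_minimal hA
  exact ⟨K, ⟨hK.prop, fun T hT hTU => hT.2 (hK.le_of_le hTU hT.1)⟩, hKA⟩

/-- Removing from `R` disjoint sets that overlap a minimal member `D` and lie in `R` up to `D`. -/
theorem diff_biUnion_mem {V ι : Type*} [DecidableEq ι] {U : Set (Set V)}
    (hS : StructSubmodular U) {D R : Set V} (hD : MinimalIn U D)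
    (hR : R ∈ U) (hRD : Disjoint R D) {A : ι → Set V} {z x : V} (hzR : z ∉ R) (hxR : x ∈ R)
    (N : Finset ι) (hdisj : ∀ i ∈ N, ∀ j ∈ N, i ≠ j → Disjoint (A i) (A j))
    (hA : ∀ i ∈ N, A i ∈ U ∧ (D ∩ A i).Nonempty ∧ ¬ D ⊆ A i ∧ (A i \ D).Nonempty ∧
      A i \ D ⊆ R ∧ z ∉ A i ∧ x ∉ A i) :
    R \ (⋃ i ∈ N, A i) ∈ U := by
  induction N using Finset.induction_on with
  | empty => simpa using hR
  | insert j N hj ih =>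
    have ih := ih (fun a ha b hb => hdisj a (Finset.mem_insert_of_mem ha) b
      (Finset.mem_insert_of_mem hb)) fun i hi => hA i (Finset.mem_insert_of_mem hi)
    obtain ⟨hjU, ⟨y, hyD, hyA⟩, hDA, ⟨u, huA, huD⟩, hAR, hzA, hxA⟩ :=
      hA j (Finset.mem_insert_self _ _)
    have hju : ∀ i ∈ N, ∀ v ∈ A j, v ∉ A i := fun i hi v hv hvi =>
      Set.disjoint_left.1 (hdisj j (Finset.mem_insert_self _ _) i (Finset.mem_insert_of_mem hi)
        (fun h => hj (h ▸ hi))) hv hvi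
    have hyR : y ∉ R := fun h => Set.disjoint_left.1 hRD h hyD
    set Q := R \ (⋃ i ∈ N, A i) with hQ
    have hmemQ : ∀ v ∈ A j, v ∈ R → v ∈ Q := fun v hv hvR =>
      ⟨hvR, by simpa using fun i hi => hju i hi v hv⟩
    have hxQ : x ∈ Q := ⟨hxR, by
      simpa using fun i hi => (hA i (Finset.mem_insert_of_mem hi)).2.2.2.2.2.2⟩
    have hcross : Crosses Q (A j) :=
      ⟨⟨u, hmemQ u huA (hAR ⟨huA, huD⟩), huA⟩, ⟨x, hxQ, hxA⟩, ⟨y, hyA, fun h => hyR h.1⟩,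
        ⟨z, trivial, fun h => h.elim (fun h => hzR h.1) hzA⟩⟩
    have hAQ : A j \ Q = A j ∩ D := by
      ext v
      constructor
      · rintro ⟨hv, hvQ⟩
        refine ⟨hv, ?_⟩
        by_contra hvD
        exact hvQ (hmemQ v hv (hAR ⟨hv, hvD⟩))
      · rintro ⟨hv, hvD⟩
        exact ⟨hv, fun h => Set.disjoint_left.1 hRD h.1 hvD⟩
    have hnot : A j \ Q ∉ U := hAQ ▸ hD.inter_notMem hDA
    have hfin := (hS Q ih (A j) hjU hcross).2.resolve_right hnot
    have heq : R \ (⋃ i ∈ insert j N, A i) = Q \ A j := by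
      rw [Finset.set_biUnion_insert, hQ, Set.sdiff_sdiff, Set.union_comm]
    rwa [heq]

/-- If `A i` are disjoint members inside `R`, each overlapped by a minimal member `D i` that
leaves `S`, and there are more points of `R` outside the `A i` than there are `D i` meeting
these points, then some member inside `R` avoids all the `A i`. -/
theorem exists_mem_disjoint {V ι : Type*} [DecidableEq ι] [DecidableEq V] {U : Set (Set V)}
    (hU : Pliable U) (hS : StructSubmodular U) {S : Set V} {z : V} (hz : z ∉ S)
    {A D : ι → Set V} (n : ℕ) : ∀ (N : Finset ι) (R : Set V) (X : Finset V), N.card = n →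
    (∀ i ∈ N, ∀ j ∈ N, i ≠ j → Disjoint (A i) (A j)) → R ∈ U → R ⊆ S →
    (∀ i ∈ N, A i ∈ U ∧ A i ⊆ R ∧ MinimalIn U (D i) ∧ (D i ∩ A i).Nonempty ∧ ¬ D i ⊆ S) →
    (∀ x ∈ X, x ∈ R ∧ ∀ i ∈ N, x ∉ A i) →
    (∀ i ∈ N, ∀ x ∈ X, ∀ y ∈ X, x ∈ D i → y ∈ D i → x = y) →
    (∃ P : Finset ι, (∀ i ∈ N, i ∉ P → ∀ x ∈ X, x ∉ D i) ∧ P ⊆ N ∧ P.card < X.card) →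
    ∃ T ∈ U, T ⊆ R ∧ ∀ i ∈ N, Disjoint T (A i) := by
  classical
  induction n using Nat.strong_induction_on with
  | _ n ih =>
  intro N R X hn hdisj hR hRS hA hX hone ⟨P, hP, hPN, hcard⟩
  rcases N.eq_empty_or_nonempty with rfl | ⟨j, hj⟩
  · exact ⟨R, hR, subset_rfl, by simp⟩
  obtain ⟨hjU, hjR, hDj, hDA, hDS⟩ := hA j hj
  have hRD : R \ D j ∈ U :=
    hU.diff_minimal_mem hR hDj (hDA.mono fun v hv => ⟨hv.1, hjR hv.2⟩) fun h => hDS (h.trans hRS)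
  set M := N.filter fun i => (D j ∩ A i).Nonempty with hM
  have hjM : j ∈ M := Finset.mem_filter.2 ⟨hj, hDA⟩
  set X' := X.filter fun x => x ∉ D j with hX'
  have hcard' : (P \ M).card < X'.card := by
    by_cases hjP : j ∈ P
    · have h1 : (P \ M).card < P.card :=
        Finset.card_lt_card ⟨Finset.sdiff_subset, fun h => (Finset.mem_sdiff.1 (h hjP)).2 hjM⟩
      have h2 : (X.filter fun x => x ∈ D j).card ≤ 1 := by
        refine Finset.card_le_one.2 fun a ha b hb => ?_
        rw [Finset.mem_filter] at ha hb
        exact hone j hj a ha.1 b hb.1 ha.2 hb.2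
      have h3 : (X.filter fun x => x ∈ D j).card + X'.card = X.card := by
        rw [hX']
        convert X.card_filter_add_card_filter_not (fun x => x ∈ D j)
      omega
    · have h1 : X' = X := Finset.filter_true_of_mem (hP j hj hjP)
      rw [h1]
      exact (Finset.card_le_card Finset.sdiff_subset).trans_lt hcard
  obtain ⟨x, hx⟩ : X'.Nonempty := Finset.card_pos.1 (by omega)
  have hxX := Finset.mem_filter.1 hx
  have hMN : ∀ i ∈ M, i ∈ N := fun i hi => (Finset.mem_filter.1 hi).1
  have hR' : (R \ D j) \ (⋃ i ∈ M, A i) ∈ U := by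
    refine diff_biUnion_mem hS hDj hRD disjoint_sdiff_self_left (z := z) (x := x)
      (fun h => hz (hRS h.1)) ⟨(hX x hxX.1).1, hxX.2⟩ M
      (fun a ha b hb => hdisj a (hMN a ha) b (hMN b hb)) fun i hi => ?_
    obtain ⟨hiN, hDi⟩ := Finset.mem_filter.1 hi
    obtain ⟨hiU, hiR, -⟩ := hA i hiN
    have hnot : ¬ D j ⊆ A i := fun h => hDS (h.trans (hiR.trans hRS))
    refine ⟨hiU, hDi, hnot, ?_, Set.sdiff_subset_sdiff_left hiR, fun h => hz (hRS (hiR h)),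
      (hX x hxX.1).2 i hiN⟩
    exact Set.nonempty_iff_ne_empty.2 fun h => hU.1 (h ▸ hU.diff_minimal_mem hiU hDj hDi hnot)
  have hsub : (R \ D j) \ (⋃ i ∈ M, A i) ⊆ R := fun v hv => hv.1.1
  have hlt : (N \ M).card < n := hn ▸
    Finset.card_lt_card ⟨Finset.sdiff_subset, fun h => (Finset.mem_sdiff.1 (h hj)).2 hjM⟩
  have hNM : ∀ i ∈ N \ M, i ∈ N ∧ i ∉ M := fun i hi => Finset.mem_sdiff.1 hi
  obtain ⟨T, hTU, hTR, hT⟩ := ih _ hlt (N \ M) _ X' rfl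
    (fun a ha b hb => hdisj a (hNM a ha).1 b (hNM b hb).1) hR' (hsub.trans hRS)
    (fun i hi => by
      obtain ⟨hiN, hiM⟩ := hNM i hi
      obtain ⟨hiU, hiR, hrest⟩ := hA i hiN
      refine ⟨hiU, fun v hv => ⟨⟨hiR hv, fun hvD => ?_⟩, ?_⟩, hrest⟩
      · exact hiM (Finset.mem_filter.2 ⟨hiN, v, hvD, hv⟩)
      · simp only [Set.mem_iUnion, not_exists]
        intro k hk hvk
        exact Set.disjoint_left.1 (hdisj i hiN k (hMN k hk) fun h => hiM (h ▸ hk)) hv hvk)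
    (fun y hy => by
      have hyX := Finset.mem_filter.1 hy
      refine ⟨⟨⟨(hX y hyX.1).1, hyX.2⟩, ?_⟩, fun i hi => (hX y hyX.1).2 i (hNM i hi).1⟩
      simp only [Set.mem_iUnion, not_exists]
      exact fun k hk => (hX y hyX.1).2 k (hMN k hk))
    (fun i hi a ha b hb => hone i (hNM i hi).1 a (Finset.mem_filter.1 ha).1 b
      (Finset.mem_filter.1 hb).1)
    ⟨P \ M, fun i hi hiP y hy => hP i (hNM i hi).1
      (fun h => hiP (Finset.mem_sdiff.2 ⟨h, (hNM i hi).2⟩)) y (Finset.mem_filter.1 hy).1,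
      Finset.sdiff_subset_sdiff hPN subset_rfl, hcard'⟩
  refine ⟨T, hTU, hTR.trans hsub, fun i hi => ?_⟩
  by_cases hiM : i ∈ M
  · refine Set.disjoint_left.2 fun v hv hvi => (hTR hv).2 ?_
    simp only [Set.mem_iUnion]
    exact ⟨i, hiM, hvi⟩
  · exact hT i (Finset.mem_sdiff.2 ⟨hi, hiM⟩)

/-- Every link of a minimal cover is the only link at some core. -/
theorem exists_core_cutLinks_eq_singleton {V : Type*} {U : Set (Set V)} {J : Set (Sym2 V)}
    (hcover : ∀ C ∈ U, (cutLinks J C).Nonempty)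
    (hmin : ∀ J' : Set (Sym2 V), J' ⊂ J → ∃ C ∈ U, cutLinks J' C = ∅)
    {ℓ : Sym2 V} (hℓ : ℓ ∈ J) : ∃ C ∈ U, cutLinks J C = {ℓ} := by
  obtain ⟨C, hC, hC0⟩ := hmin (J \ {ℓ}) ⟨Set.sdiff_subset, fun h => (h hℓ).2 rfl⟩
  refine ⟨C, hC, (hcover C hC).subset_singleton_iff.1 ?_⟩
  rintro e ⟨heJ, he⟩
  by_contra hne
  exact Set.eq_empty_iff_forall_notMem.1 hC0 e ⟨⟨heJ, hne⟩, he⟩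

/-- In a laminar family, a set `C ⊆ S` whose smallest superset in the family is neither `S` nor
a child of `S` lies in a proper descendant of a child of `S`. -/
theorem exists_ssubset_child {V : Type*} [Finite V] {L : Set (Set V)} {S C : Set V} (hS : S ∈ L)
    (hlam : ∀ A ∈ L, ∀ B ∈ L, A ⊆ B ∨ B ⊆ A ∨ Disjoint A B)
    (hC : C.Nonempty) (hCS : C ⊆ S) (h1 : ¬ SmallestContaining L C S)
    (h2 : ∀ A, IsChild L S A → ¬ SmallestContaining L C A) :
    ∃ T ∈ L, ∃ A, IsChild L S A ∧ C ⊆ T ∧ T ⊂ A := by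
  obtain ⟨T, hTS, hT⟩ := (Set.toFinite {T | T ∈ L ∧ C ⊆ T}).exists_le_minimal ⟨hS, hCS⟩
  have hsm : SmallestContaining L C T := by
    refine ⟨hT.prop.2, ?_⟩
    rintro B (rfl | hB) hCB
    · exact Set.subset_univ _
    · rcases hlam T hT.prop.1 B hB with h | h | h
      · exact h
      · exact hT.le_of_le ⟨hB, hCB⟩ h
      · obtain ⟨x, hx⟩ := hC
        exact (Set.disjoint_left.1 h (hT.prop.2 hx) (hCB hx)).elim
  have hTS' : T ⊂ S := hTS.ssubset_of_ne fun h => h1 (h ▸ hsm)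
  obtain ⟨A, hTA, hA⟩ := (Set.toFinite {A | A ∈ L ∧ A ⊂ S}).exists_le_maximal ⟨hT.prop.1, hTS'⟩
  have hch : IsChild L S A :=
    ⟨hA.prop.1, hA.prop.2, fun ⟨B, hB, hAB, hBS⟩ => hAB.2 (hA.le_of_ge ⟨hB, hBS⟩ hAB.1)⟩
  exact ⟨T, hT.prop.1, A, hch, hT.prop.2, hTA.ssubset_of_ne fun h => h2 A hch (h ▸ hsm)⟩

/-- for every `S ∈ L*` there is a core `C` with `ψ(C) = S` or
`ψ(C) = S'` for some child `S'` of `S` in `L*`. -/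
theorem stmt11 {V : Type*} [Fintype V] (F : Set (Set V)) (E : Set (Sym2 V))
    (J : Set (Sym2 V)) (w : Sym2 V → Set V)
    (hPl : Pliable F) (hSym : SymmFamily F) (hSub : StructSubmodular F)
    (hcover : ∀ C ∈ cores F E, (cutLinks J C).Nonempty)
    (hmin : ∀ J' : Set (Sym2 V), J' ⊂ J → ∃ C ∈ cores F E, cutLinks J' C = ∅)
    (hwit : ∀ ℓ ∈ J, w ℓ ∈ uncovered F E ∧ cutLinks J (w ℓ) = {ℓ})
    (hlam : ∀ ℓ ∈ J, ∀ ℓ' ∈ J, w ℓ ⊆ w ℓ' ∨ w ℓ' ⊆ w ℓ ∨ Disjoint (w ℓ) (w ℓ')) :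
    ∀ S ∈ witnessCross F E J w, ∃ C ∈ cores F E,
      SmallestContaining (witnessCross F E J w) C S ∨
      ∃ S', IsChild (witnessCross F E J w) S S' ∧
        SmallestContaining (witnessCross F E J w) C S' := by
  classical
  intro S hSL
  by_contra hcon
  push Not at hcon
  set U := uncovered F E
  set L := witnessCross F E J w
  have hU : Pliable U := hPl.uncovered E
  have hSU : StructSubmodular U := hSub.uncovered E
  have hlamL : ∀ A ∈ L, ∀ B ∈ L, A ⊆ B ∨ B ⊆ A ∨ Disjoint A B := by
    rintro _ ⟨⟨ℓ, hℓ, rfl⟩, -⟩ _ ⟨⟨ℓ', hℓ', rfl⟩, -⟩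
    exact hlam ℓ hℓ ℓ' hℓ'
  have hdesc : ∀ C, MinimalIn U C → C ⊆ S → ∃ T ∈ L, ∃ A, IsChild L S A ∧ C ⊆ T ∧ T ⊂ A :=
    fun C hC hCS => exists_ssubset_child hSL hlamL (hC.nonempty hU) hCS (hcon C hC).1 (hcon C hC).2
  obtain ⟨⟨ℓS, hℓS, hSw⟩, -⟩ := id hSL
  have hwU : ∀ ℓ ∈ J, w ℓ ∈ U := fun ℓ hℓ => (hwit ℓ hℓ).1
  have hcut : ∀ ℓ ∈ J, ∀ ℓ' ∈ J, ℓ' ∈ cutLinks J (w ℓ) → ℓ' = ℓ := fun ℓ hℓ ℓ' _ h => by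
    rw [(hwit ℓ hℓ).2] at h
    exact h
  have hends : ∀ ℓ ∈ J, ∃ x y, ℓ = s(x, y) ∧ x ∈ w ℓ ∧ y ∉ w ℓ := fun ℓ hℓ => by
    have : ℓ ∈ cutLinks J (w ℓ) := by
      rw [(hwit ℓ hℓ).2]
      rfl
    exact this.2
  have : Nonempty V := let ⟨x, _⟩ := hends ℓS hℓS; ⟨x⟩
  choose! c d hcd hc hd using hends
  have hcutc : ∀ ℓ ∈ J, ∀ ℓ' ∈ J, c ℓ' ∈ w ℓ → d ℓ' ∉ w ℓ → ℓ' = ℓ := fun ℓ hℓ ℓ' hℓ' h h' =>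
    hcut ℓ hℓ ℓ' hℓ' ⟨hℓ', _, _, hcd ℓ' hℓ', h, h'⟩
  have hcutd : ∀ ℓ ∈ J, ∀ ℓ' ∈ J, d ℓ' ∈ w ℓ → c ℓ' ∉ w ℓ → ℓ' = ℓ := fun ℓ hℓ ℓ' hℓ' h h' =>
    hcut ℓ hℓ ℓ' hℓ' ⟨hℓ', _, _, (hcd ℓ' hℓ').trans Sym2.eq_swap, h, h'⟩
  have hK : ∀ ℓ ∈ J, ∃ C ∈ cores F E, cutLinks J C = {ℓ} := fun ℓ hℓ =>
    exists_core_cutLinks_eq_singleton hcover hmin hℓ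
  choose! K hKcore hKcut using hK
  have hKmin : ∀ ℓ ∈ J, MinimalIn U (K ℓ) := hKcore
  have hKends : ∀ ℓ ∈ J, c ℓ ∈ K ℓ ∧ d ℓ ∉ K ℓ ∨ d ℓ ∈ K ℓ ∧ c ℓ ∉ K ℓ := fun ℓ hℓ => by
    have : ℓ ∈ cutLinks J (K ℓ) := by
      rw [hKcut ℓ hℓ]
      rfl
    obtain ⟨-, x, y, hxy, hx, hy⟩ := this
    rw [hcd ℓ hℓ, Sym2.eq_iff] at hxy
    rcases hxy with ⟨h1, h2⟩ | ⟨h1, h2⟩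
    · exact .inl ⟨h1 ▸ hx, h2 ▸ hy⟩
    · exact .inr ⟨h2 ▸ hx, h1 ▸ hy⟩
  have hKeq : ∀ ℓ ∈ J, ∀ ℓ' ∈ J, ∀ v, v ∈ K ℓ → v ∈ K ℓ' → K ℓ = K ℓ' := fun ℓ hℓ ℓ' hℓ' v h h' =>
    (hKmin ℓ hℓ).eq_of_inter_nonempty hU (hKmin ℓ' hℓ') ⟨v, h, h'⟩
  have hKuniq : ∀ ℓ ∈ J, ∀ ℓ' ∈ J, c ℓ ∈ K ℓ' ∨ d ℓ ∈ K ℓ' → ℓ = ℓ' := by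
    intro ℓ hℓ ℓ' hℓ' h
    have hmem : ℓ ∈ cutLinks J (K ℓ') := by
      by_cases h1 : c ℓ ∈ K ℓ' <;> by_cases h2 : d ℓ ∈ K ℓ'
      · rcases hKends ℓ hℓ with h3 | h3
        · have := hKeq ℓ hℓ ℓ' hℓ' _ h3.1 h1
          exact (h3.2 (this ▸ h2)).elim
        · have := hKeq ℓ hℓ ℓ' hℓ' _ h3.1 h2
          exact (h3.2 (this ▸ h1)).elim
      · exact ⟨hℓ, _, _, hcd ℓ hℓ, h1, h2⟩
      · exact ⟨hℓ, _, _, (hcd ℓ hℓ).trans Sym2.eq_swap, h2, h1⟩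
      · exact (h.elim h1 h2).elim
    rw [hKcut ℓ' hℓ'] at hmem
    exact hmem
  let N : Finset (Sym2 V) := Finset.univ.filter fun ℓ => ℓ ∈ J ∧ IsChild L S (w ℓ)
  have hN : ∀ {ℓ}, ℓ ∈ N ↔ ℓ ∈ J ∧ IsChild L S (w ℓ) := by simp [N]
  have hinj : ∀ ℓ ∈ J, ∀ ℓ' ∈ J, w ℓ = w ℓ' → ℓ = ℓ' := fun ℓ hℓ ℓ' hℓ' h =>
    hcutc ℓ' hℓ' ℓ hℓ (h ▸ hc ℓ hℓ) (h ▸ hd ℓ hℓ)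
  have hdisjC : ∀ A B, IsChild L S A → IsChild L S B → A ≠ B → Disjoint A B := by
    intro A B hA hB hne
    rcases hlamL A hA.1 B hB.1 with h | h | h
    · exact (hA.2.2 ⟨B, hB.1, h.ssubset_of_ne hne, hB.2.1⟩).elim
    · exact (hB.2.2 ⟨A, hA.1, h.ssubset_of_ne hne.symm, hA.2.1⟩).elim
    · exact h
  have hdisj : ∀ i ∈ N, ∀ j ∈ N, i ≠ j → Disjoint (w i) (w j) := fun i hi j hj hne =>
    hdisjC _ _ (hN.1 hi).2 (hN.1 hj).2 fun h => hne (hinj i (hN.1 hi).1 j (hN.1 hj).1 h)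
  have hNS : ∀ i ∈ N, i ≠ ℓS := fun i hi h => by
    have := (hN.1 hi).2.2.1
    rw [h, ← hSw] at this
    exact ssubset_irrefl _ this
  have hSends : c ℓS ∈ S ∧ d ℓS ∉ S := hSw ▸ ⟨hc ℓS hℓS, hd ℓS hℓS⟩
  have hD : ∀ i ∈ N, ∃ D, MinimalIn U D ∧ (D ∩ w i).Nonempty ∧ ¬ D ⊆ S ∧
      (c i ∈ K i → D = K i) := by
    intro i hi
    obtain ⟨hiJ, hich⟩ := hN.1 hi
    by_cases hci : c i ∈ K i
    · refine ⟨K i, hKmin i hiJ, ⟨_, hci, hc i hiJ⟩, fun hKS => ?_, fun _ => rfl⟩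
      obtain ⟨T, hTL, A, hA, hKT, hTA⟩ := hdesc _ (hKmin i hiJ) hKS
      have hAi : A = w i := by
        by_contra hne
        exact Set.disjoint_left.1 (hdisjC _ _ hA hich hne) (hTA.1 (hKT hci)) (hc i hiJ)
      obtain ⟨⟨t, htJ, rfl⟩, -⟩ := hTL
      have := hcutc t htJ i hiJ (hKT hci) fun h => hd i hiJ (hAi ▸ hTA.1 h)
      rw [hAi, this] at hTA
      exact ssubset_irrefl _ hTA
    · obtain ⟨D, hDc, hcr⟩ := hich.1.2
      refine ⟨D, hDc, ?_, fun hDS => ?_, fun h => (hci h).elim⟩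
      · rw [Set.inter_comm]
        exact hcr.1
      · obtain ⟨T, -, A, hA, hDT, hTA⟩ := hdesc D hDc hDS
        obtain ⟨x, hx, hxD⟩ := hcr.1
        obtain ⟨y, hyD, hy⟩ := hcr.2.2.1
        have hAi : A = w i := by
          by_contra hne
          exact Set.disjoint_left.1 (hdisjC _ _ hA hich hne) (hTA.1 (hDT hxD)) hx
        exact hy (hAi ▸ hTA.1 (hDT hyD))
  choose! D hDmin hDw hDS hDK using hD
  let P : Finset (Sym2 V) := N.filter fun i => c i ∉ K i
  have hP : ∀ {i}, i ∈ P ↔ i ∈ N ∧ c i ∉ K i := by simp [P]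
  have hPd : ∀ i ∈ P, d i ∈ K i := fun i hi =>
    (hKends i (hN.1 (hP.1 hi).1).1).elim (fun h => ((hP.1 hi).2 h.1).elim) And.left
  have hPJ : ∀ i ∈ P, i ∈ J := fun i hi => (hN.1 (hP.1 hi).1).1
  have hPS : ∀ i ∈ P, i ≠ ℓS := fun i hi => hNS i (hP.1 hi).1
  let X : Finset V := insert (c ℓS) (P.image d)
  have hX : ∀ {x}, x ∈ X ↔ x = c ℓS ∨ ∃ i ∈ P, d i = x := by simp [X]
  have hXcard : P.card < X.card := by
    have h1 : c ℓS ∉ P.image d := by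
      simp only [Finset.mem_image, not_exists, not_and]
      intro i hi h
      exact hPS i hi (hKuniq ℓS hℓS i (hPJ i hi) (.inl (h ▸ hPd i hi))).symm
    have h2 : (P.image d).card = P.card := Finset.card_image_of_injOn fun i hi j hj h =>
      hKuniq i (hPJ i hi) j (hPJ j hj) (.inr (by rw [show d i = d j from h]; exact hPd j hj))
    rw [Finset.card_insert_of_notMem h1, h2]
    exact Nat.lt_succ_self _
  have hKX : ∀ i ∈ P, ∀ x ∈ X, x ∈ K i → x = d i := by
    intro i hi x hx hxK
    rcases hX.1 hx with rfl | ⟨j, hj, rfl⟩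
    · exact (hPS i hi (hKuniq ℓS hℓS i (hPJ i hi) (.inl hxK)).symm).elim
    · rw [hKuniq j (hPJ j hj) i (hPJ i hi) (.inr hxK)]
  have hchS : ∀ i ∈ N, w i ⊆ S := fun i hi => (hN.1 hi).2.2.1.1
  obtain ⟨T, hTU, hTS, hT⟩ := exists_mem_disjoint hU hSU hSends.2 (A := w) (D := D) N.card N S X
    rfl hdisj (hSw ▸ hwU ℓS hℓS) subset_rfl
    (fun i hi => ⟨hwU i (hN.1 hi).1, hchS i hi, hDmin i hi, hDw i hi, hDS i hi⟩)
    (by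
      intro x hx
      rcases hX.1 hx with rfl | ⟨j, hj, rfl⟩
      · exact ⟨hSends.1, fun i hi h => hNS i hi
          (hcutc i (hN.1 hi).1 ℓS hℓS h fun h' => hSends.2 (hchS i hi h')).symm⟩
      · have hjN := (hP.1 hj).1
        have hjJ := hPJ j hj
        constructor
        · by_contra h
          exact hPS j hj (hcutc ℓS hℓS j hjJ (hSw ▸ hchS j hjN (hc j hjJ)) (hSw ▸ h))
        · intro i hi h
          by_cases hij : j = i
          · exact hd j hjJ (hij ▸ h)
          · exact hij (hcutd i (hN.1 hi).1 j hjJ h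
              (Set.disjoint_left.1 (hdisj j hjN i hi hij) (hc j hjJ))))
    (by
      have key : ∀ i ∈ N, ∀ j ∈ P, ∀ y ∈ X, d j ∈ D i → y ∈ D i → d j = y := by
        intro i hi j hj y hy hjD hyD
        have := (hDmin i hi).eq_of_inter_nonempty hU (hKmin j (hPJ j hj)) ⟨_, hjD, hPd j hj⟩
        exact (hKX j hj y hy (this ▸ hyD)).symm
      intro i hi x hx y hy hxD hyD
      rcases hX.1 hx with rfl | ⟨j, hj, rfl⟩
      · rcases hX.1 hy with rfl | ⟨k, hk, rfl⟩
        · rfl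
        · exact (key i hi k hk _ hx hyD hxD).symm
      · exact key i hi j hj y hy hxD hyD)
    ⟨P, by
      intro i hi hiP x hx hxD
      have hci : c i ∈ K i := by
        by_contra h
        exact hiP (hP.2 ⟨hi, h⟩)
      rw [hDK i hi hci] at hxD
      rcases hX.1 hx with rfl | ⟨j, hj, rfl⟩
      · exact hNS i hi (hKuniq ℓS hℓS i (hN.1 hi).1 (.inl hxD)).symm
      · exact hiP (hKuniq j (hPJ j hj) i (hN.1 hi).1 (.inr hxD) ▸ hj),
      Finset.filter_subset _ _, hXcard⟩
  obtain ⟨C, hC, hCT⟩ := exists_minimalIn_subset hTU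
  obtain ⟨T', -, A, hA, hCT', hTA⟩ := hdesc C hC (hCT.trans hTS)
  obtain ⟨⟨i, hiJ, rfl⟩, -⟩ := id hA.1
  obtain ⟨x, hx⟩ := hC.nonempty hU
  exact Set.disjoint_left.1 (hT i (hN.2 ⟨hiJ, hA⟩)) (hCT hx) (hTA.1 (hCT' hx))
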